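/- Let s_α = sup{ q·(k_α − p) : q ∈ [0,1], p ∈ [0,k_α], (1−α)·q·k_α − q·p·log q > r_α } (the supremum of the empty set being 0). If s ≥ s_α, then for every q ∈ (0,1], (1−α)·q·k_α − (q·k_α − s)·log q ≤ r_α. -/

import Mathlib

open Real Set MeasureTheory

noncomputable section

/-- `V` is an inverse-demand function: antitone, upper-semicontinuous, with values in `[0, vbar]`. -/
def IsDemand (vbar : ℝ) (V : ℝ → ℝ) : Prop :=
  AntitoneOn V (Icc 0 1) ∧ UpperSemicontinuousOn V (Icc 0 1) ∧
    ∀ z ∈ Icc (0:ℝ) 1, V z ∈ Icc 0 vbar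

/-- `C` is a cost function: monotone increasing, lower-semicontinuous, nonnegative, `C 0 = 0`. -/
def IsCost (C : ℝ → ℝ) : Prop :=
  MonotoneOn C (Icc 0 1) ∧ LowerSemicontinuousOn C (Icc 0 1) ∧
    (∀ z ∈ Icc (0:ℝ) 1, 0 ≤ C z) ∧ C 0 = 0

/-- `(q, p)` is feasible under the inverse-demand function `V`. -/
def Feasible (vbar : ℝ) (V : ℝ → ℝ) (q p : ℝ) : Prop :=
  q ∈ Icc (0:ℝ) 1 ∧ p ∈ Icc (0:ℝ) vbar ∧ p ≤ V q

/-- The social optimum `OPT(V, C)`. -/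
def OPT (V C : ℝ → ℝ) : ℝ :=
  sSup { x | ∃ q ∈ Icc (0:ℝ) 1, x = (∫ z in (0:ℝ)..q, V z) - C q }

/-- `ρ` is a policy: upper-semicontinuous with `ρ 0 0 ≥ 0`. -/
def IsPolicy (vbar : ℝ) (ρ : ℝ → ℝ → ℝ) : Prop :=
  UpperSemicontinuousOn (fun x : ℝ × ℝ => ρ x.1 x.2) (Icc 0 1 ×ˢ Icc 0 vbar) ∧ 0 ≤ ρ 0 0

/-- `(q, p)` is a firm's best response to `(V, C)` under the policy `ρ`. -/
def BestResponse (vbar : ℝ) (V C : ℝ → ℝ) (ρ : ℝ → ℝ → ℝ) (q p : ℝ) : Prop :=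
  Feasible vbar V q p ∧
    ∀ q' p', Feasible vbar V q' p' → ρ q' p' - C q' ≤ ρ q p - C q

/-- The regret `RGRT = DSTR + (1 - α) * FP`. -/
def RGRT (vbar α : ℝ) (V C : ℝ → ℝ) (ρ : ℝ → ℝ → ℝ) (q p : ℝ) : ℝ :=
  (OPT V C - ((∫ z in (0:ℝ)..q, V z) - C q)) + (1 - α) * (ρ q p - C q)

/-- The worst-case regret of a policy `ρ` (as an extended real, since the supremum
ranges over all demand/cost scenarios and best responses). -/
def WCR (vbar α : ℝ) (ρ : ℝ → ℝ → ℝ) : EReal :=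
  sSup { r : EReal | ∃ V C q p, IsDemand vbar V ∧ IsCost C ∧
    BestResponse vbar V C ρ q p ∧ r = ((RGRT vbar α V C ρ q p : ℝ) : EReal) }

/-- The price-cap level `k_α = v̄ / (2 - α)`. -/
def kcap (vbar α : ℝ) : ℝ := vbar / (2 - α)

/-- The objective `min((1-α) q k_α - q p log q, q (k_α - p))`.
(Note `Real.log 0 = 0`, so `q * p * log q` is `0` at `q = 0` as required.) -/
def regretFn (vbar α q p : ℝ) : ℝ :=
  min ((1 - α) * q * kcap vbar α - q * p * Real.log q) (q * (kcap vbar α - p))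

/-- The lower bound `r_α` on the worst-case regret. -/
def rbound (vbar α : ℝ) : ℝ :=
  sSup { x | ∃ q ∈ Icc (0:ℝ) 1, ∃ p ∈ Icc (0:ℝ) (kcap vbar α), x = regretFn vbar α q p }

/-- The subsidy level `s_α`. (`Real.sSup ∅ = 0`, matching the convention for the empty set.) -/
def sbound (vbar α : ℝ) : ℝ :=
  sSup { x | ∃ q ∈ Icc (0:ℝ) 1, ∃ p ∈ Icc (0:ℝ) (kcap vbar α),
    (1 - α) * q * kcap vbar α - q * p * Real.log q > rbound vbar α ∧
      x = q * (kcap vbar α - p) }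


/-- Every value of the objective is at most `r_α`. -/
lemma regretFn_le_rbound {vbar α q p : ℝ} (hq : q ∈ Icc (0:ℝ) 1)
    (hp : p ∈ Icc (0:ℝ) (kcap vbar α)) : regretFn vbar α q p ≤ rbound vbar α := by
  refine le_csSup ⟨kcap vbar α, ?_⟩ ⟨q, hq, p, hp, rfl⟩
  rintro x ⟨q', ⟨hq0, hq1⟩, p', ⟨hp0, hpk⟩, rfl⟩
  refine (min_le_right _ _).trans ?_
  nlinarith

/-- If the first term of the objective exceeds `r_α`, the second one is at most `s_α`. -/
lemma mul_kcap_sub_le_sbound {vbar α q p : ℝ} (hq : q ∈ Icc (0:ℝ) 1)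
    (hp : p ∈ Icc (0:ℝ) (kcap vbar α))
    (h : (1 - α) * q * kcap vbar α - q * p * Real.log q > rbound vbar α) :
    q * (kcap vbar α - p) ≤ sbound vbar α := by
  refine le_csSup ⟨kcap vbar α, ?_⟩ ⟨q, hq, p, hp, h, rfl⟩
  rintro x ⟨q', ⟨hq0, hq1⟩, p', ⟨hp0, hpk⟩, -, rfl⟩
  nlinarith

lemma sbound_nonneg (vbar α : ℝ) : 0 ≤ sbound vbar α := by
  refine Real.sSup_nonneg ?_
  rintro x ⟨q, hq, p, hp, -, rfl⟩
  exact mul_nonneg hq.1 (sub_nonneg.2 hp.2)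

/-- If `s ≥ s_alpha`, then for every `q ∈ (0, 1]`,
`(1 - alpha) * q * k_alpha - (q * k_alpha - s) * log q ≤ r_alpha`. -/
theorem subsidy_bound_implies_underproduction_bound
    (vbar alpha : ℝ) (hv : 0 < vbar) (halpha : alpha ∈ Icc (0:ℝ) 1)
    (s : ℝ) (hs : sbound vbar alpha ≤ s) :
    ∀ q ∈ Ioc (0:ℝ) 1,
      (1 - alpha) * q * kcap vbar alpha - (q * kcap vbar alpha - s) * Real.log q ≤
        rbound vbar alpha := by
  rintro q ⟨hq0, hq1⟩
  have hk : 0 ≤ kcap vbar alpha := div_nonneg hv.le (by linarith [halpha.2])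
  have hq : q ∈ Icc (0:ℝ) 1 := ⟨hq0.le, hq1⟩
  have hlog : Real.log q ≤ 0 := Real.log_nonpos hq0.le hq1
  have hs0 : 0 ≤ s := (sbound_nonneg vbar alpha).trans hs
  have hbase : (1 - alpha) * q * kcap vbar alpha ≤ rbound vbar alpha := by
    have h := regretFn_le_rbound (vbar := vbar) (α := alpha) hq ⟨le_rfl, hk⟩
    have hqk : 0 ≤ alpha * (q * kcap vbar alpha) :=
      mul_nonneg halpha.1 (mul_nonneg hq0.le hk)
    rw [regretFn, min_eq_left (by nlinarith)] at h
    linarith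
  rcases le_or_gt (q * kcap vbar alpha) s with hqs | hqs
  · nlinarith
  -- Every price below `k - s / q` violates the constraint defining `s_α`; let it tend to `k - s / q`.
  have hbelow : ∀ u, 0 ≤ u → u < q * kcap vbar alpha - s →
      (1 - alpha) * q * kcap vbar alpha - u * Real.log q ≤ rbound vbar alpha := by
    intro u hu0 hu
    by_contra! hgt
    have hqu : q * (u / q) = u := mul_div_cancel₀ u hq0.ne'
    have hle : q * (kcap vbar alpha - u / q) ≤ sbound vbar alpha := by
      refine mul_kcap_sub_le_sbound hq ⟨div_nonneg hu0 hq0.le, ?_⟩ (by rwa [hqu])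
      rw [div_le_iff₀ hq0]
      linarith
    rw [mul_sub, hqu] at hle
    linarith
  have hcont : Continuous fun u : ℝ =>
      (1 - alpha) * q * kcap vbar alpha - u * Real.log q := by fun_prop
  refine le_of_tendsto (hcont.continuousWithinAt (s := Iio (q * kcap vbar alpha - s))) ?_
  filter_upwards [Ico_mem_nhdsLT (sub_pos.2 hqs)] with u hu
  exact hbelow u hu.1 hu.2
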